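/- Let F : {0,1}² → ℝ≥0 with entries f_{ab} = F(a,b), and assume f_{01} ≥ f_{10}. Then: (i) if f_{00}f_{11} = f_{01}f_{10}, then ⟨F, ℬ₁⟩_ω = ⟨ℬ₁⟩_ω; (ii) if f_{01} = f_{10} = 0 and f_{00}, f_{11} > 0, then ⟨F, ℬ₁⟩_ω = ⟨ℬ₁⟩_ω; (iii) if f_{00} = f_{11} = 0 and f_{01}, f_{10} > 0, then ⟨F, ℬ₁⟩_ω = ⟨NEQ, ℬ₁⟩_ω; (iv) if f_{00}, f_{01}, f_{11} > 0 and f_{00}f_{11} > f_{01}f_{10}, then ⟨F, ℬ₁⟩_ω = ⟨IMP, ℬ₁⟩_ω; (v) in all remaining cases, ⟨F, ℬ₁⟩_ω = ⟨OR, ℬ₁⟩_ω. -/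

import Mathlib

open scoped NNReal BigOperators

/-- Functions of arity `n` on the Boolean domain with values in `R`. -/
abbrev FnOn (R : Type) (n : ℕ) : Type := (Fin n → Bool) → R

/-- Functions of all arities on the Boolean domain with values in `R`. -/
abbrev Fn (R : Type) : Type := Σ n : ℕ, FnOn R n

/-- The binary equality function: `EQ(x,x) = 1`, `EQ(x,y) = 0` for `x ≠ y`. -/
def EQfn (R : Type) [CommSemiring R] : Fn R :=
  ⟨2, fun x => if x 0 = x 1 then 1 else 0⟩

/-- `F` (of arity `n`) is representable by a pps-formula over `𝓕`: there are `m` bound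
variables and `s` atomic formulas, the `j`-th atomic formula applying `G j ∈ 𝓕` to a
scope `σ j` of (possibly repeated) variables among the `n + m` variables; `F x` is the
sum over all Boolean assignments of the bound variables of the product of the values of
the atomic formulas. -/
def PpsRep (R : Type) [CommSemiring R] (𝓕 : Set (Fn R)) {n : ℕ} (F : FnOn R n) : Prop :=
  ∃ (m s : ℕ) (G : Fin s → Fn R) (σ : (j : Fin s) → Fin (G j).1 → Fin (n + m)),
    (∀ j, G j ∈ 𝓕) ∧
    ∀ x : Fin n → Bool,
      F x = ∑ y : Fin m → Bool, ∏ j : Fin s, (G j).2 (fun i => Fin.append x y (σ j i))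

/-- The functional clone `⟨𝓕⟩` generated by `𝓕`: all functions representable by a
pps-formula over `𝓕 ∪ {EQ}`. -/
def Clone (R : Type) [CommSemiring R] (𝓕 : Set (Fn R)) : Set (Fn R) :=
  {F | PpsRep R (𝓕 ∪ {EQfn R}) F.2}

/-- The pps_ω-definable functional clone `⟨𝓕⟩_ω`: all functions `F` such that for some
finite `S ⊆ 𝓕 ∪ {EQ}` and every `ε > 0`, some function of the same arity representable
by a pps-formula over `S` is within `ε` of `F` in the sup norm. -/
def CloneOmega (R : Type) [CommSemiring R] [MetricSpace R] (𝓕 : Set (Fn R)) :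
    Set (Fn R) :=
  {F | ∃ S : Set (Fn R), S ⊆ 𝓕 ∪ {EQfn R} ∧ S.Finite ∧
    ∀ ε : ℝ, 0 < ε → ∃ Fhat : FnOn R F.1, PpsRep R S Fhat ∧
      ∀ x : Fin F.1 → Bool, dist (Fhat x) (F.2 x) < ε}

/-- `IMP(x,y) = 0` if `(x,y) = (1,0)`, and `1` otherwise. -/
def IMPfn : Fn ℝ≥0 := ⟨2, fun x => if x 0 = true ∧ x 1 = false then 0 else 1⟩

/-- `NEQ(x,y) = 1` iff `x ≠ y`, else `0`. -/
def NEQfn : Fn ℝ≥0 := ⟨2, fun x => if x 0 ≠ x 1 then 1 else 0⟩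

/-- `OR(x,y) = 0` if `(x,y) = (0,0)`, and `1` otherwise. -/
def ORfn : Fn ℝ≥0 := ⟨2, fun x => if x 0 = false ∧ x 1 = false then 0 else 1⟩

/-- `ℬ₁`: the set of all unary functions `{0,1} → ℝ≥0`. -/
def unaryFns : Set (Fn ℝ≥0) := {F | F.1 = 1}

/-- A pps-formula may have its bound variables and its atomic formulas indexed by arbitrary
finite types. -/
theorem PpsRep.of_fintype {R : Type} [CommSemiring R] {𝓕 : Set (Fn R)} {n : ℕ} {F : FnOn R n}
    {B J : Type} [Fintype B] [DecidableEq B] [Fintype J] (G : J → Fn R)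
    (σ : (j : J) → Fin (G j).1 → Fin n ⊕ B) (hG : ∀ j, G j ∈ 𝓕)
    (hF : ∀ x, F x = ∑ y : B → Bool, ∏ j, (G j).2 (fun i => Sum.elim x y (σ j i))) :
    PpsRep R 𝓕 F := by
  let e := Fintype.equivFin B
  let d := Fintype.equivFin J
  refine ⟨Fintype.card B, Fintype.card J, fun j => G (d.symm j),
    fun j i => finSumFinEquiv (Sum.map id e (σ (d.symm j) i)), fun j => hG _, fun x => ?_⟩
  rw [hF x, ← (e.arrowCongr (Equiv.refl Bool)).sum_comp]
  refine Finset.sum_congr rfl fun y _ => ?_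
  rw [← d.symm.prod_comp]
  refine Finset.prod_congr rfl fun j _ => congrArg _ (funext fun i => ?_)
  cases h : σ (d.symm j) i <;> simp [Equiv.arrowCongr, h]

/-- Every pps-formula can be written with its variables indexed by a sum type. -/
theorem PpsRep.exists_sum {R : Type} [CommSemiring R] {𝓕 : Set (Fn R)} {n : ℕ} {F : FnOn R n}
    (h : PpsRep R 𝓕 F) :
    ∃ (m s : ℕ) (G : Fin s → Fn R) (σ : (j : Fin s) → Fin (G j).1 → Fin n ⊕ Fin m),
      (∀ j, G j ∈ 𝓕) ∧ ∀ x, F x =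
        ∑ y : Fin m → Bool, ∏ j, (G j).2 (fun i => Sum.elim x y (σ j i)) := by
  obtain ⟨m, s, G, σ, hG, hF⟩ := h
  refine ⟨m, s, G, fun j i => finSumFinEquiv.symm (σ j i), hG, fun x => ?_⟩
  rw [hF x]
  refine Finset.sum_congr rfl fun y _ => Finset.prod_congr rfl fun j _ =>
    congrArg _ (funext fun i => ?_)
  obtain ⟨t, ht⟩ := finSumFinEquiv.surjective (σ j i)
  simp only [← ht, Equiv.symm_apply_apply]
  rcases t with a | b <;> simp

theorem PpsRep.one {R : Type} [CommSemiring R] (𝓕 : Set (Fn R)) (n : ℕ) :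
    PpsRep R 𝓕 (1 : FnOn R n) :=
  PpsRep.of_fintype (B := Empty) (J := Empty) (fun j => j.elim) (fun j => j.elim)
    (fun j => j.elim) (fun x => by simp)

theorem PpsRep.mul {R : Type} [CommSemiring R] {𝓕 : Set (Fn R)} {n : ℕ} {F F' : FnOn R n}
    (h : PpsRep R 𝓕 F) (h' : PpsRep R 𝓕 F') : PpsRep R 𝓕 (F * F') := by
  obtain ⟨m, s, G, σ, hG, hF⟩ := h.exists_sum
  obtain ⟨m', s', G', σ', hG', hF'⟩ := h'.exists_sum
  refine PpsRep.of_fintype (B := Fin m ⊕ Fin m') (J := Fin s ⊕ Fin s') (Sum.elim G G')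
    (fun j => match j with
      | Sum.inl j => fun i => Sum.map id Sum.inl (σ j i)
      | Sum.inr j => fun i => Sum.map id Sum.inr (σ' j i))
    (fun j => by rcases j with j | j <;> simp [hG, hG']) (fun x => ?_)
  rw [Pi.mul_apply, hF x, hF' x, Finset.sum_mul_sum, ← Finset.sum_product',
    Finset.univ_product_univ,
    ← (Equiv.sumArrowEquivProdArrow (Fin m) (Fin m') Bool).sum_comp]
  refine Finset.sum_congr rfl fun y _ => ?_
  rw [Fintype.prod_sum_type]
  congr 1 <;> refine Finset.prod_congr rfl fun j _ => congrArg _ (funext fun i => ?_)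
  · simp only
    rcases σ j i with a | b <;> simp [Equiv.sumArrowEquivProdArrow]
  · simp only
    rcases σ' j i with a | b <;> simp [Equiv.sumArrowEquivProdArrow]

theorem PpsRep.rename {R : Type} [CommSemiring R] {𝓕 : Set (Fn R)} {k n : ℕ} {F : FnOn R k}
    (h : PpsRep R 𝓕 F) (τ : Fin k → Fin n) : PpsRep R 𝓕 (fun x : Fin n → Bool => F (x ∘ τ)) := by
  obtain ⟨m, s, G, σ, hG, hF⟩ := h.exists_sum
  refine PpsRep.of_fintype G (fun j i => Sum.map τ id (σ j i)) hG (fun x => ?_)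
  rw [hF]
  refine Finset.sum_congr rfl fun y _ => Finset.prod_congr rfl fun j _ =>
    congrArg _ (funext fun i => ?_)
  rcases σ j i with a | b <;> simp

theorem PpsRep.sum {R : Type} [CommSemiring R] {𝓕 : Set (Fn R)} {n k : ℕ} {F : FnOn R (n + k)}
    (h : PpsRep R 𝓕 F) :
    PpsRep R 𝓕 (fun x : Fin n → Bool => ∑ y : Fin k → Bool, F (Fin.append x y)) := by
  obtain ⟨m, s, G, σ, hG, hF⟩ := h.exists_sum
  refine PpsRep.of_fintype (B := Fin k ⊕ Fin m) G
    (fun j i => Equiv.sumAssoc _ _ _ (Sum.map finSumFinEquiv.symm id (σ j i))) hG (fun x => ?_)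
  simp only [hF]
  rw [← Finset.sum_product', Finset.univ_product_univ,
    ← (Equiv.sumArrowEquivProdArrow (Fin k) (Fin m) Bool).sum_comp]
  refine Finset.sum_congr rfl fun y _ => Finset.prod_congr rfl fun j _ =>
    congrArg _ (funext fun i => ?_)
  rcases σ j i with a | b
  · obtain ⟨t, rfl⟩ := finSumFinEquiv.surjective a
    rcases t with a | b <;> simp [Equiv.sumArrowEquivProdArrow]
  · simp [Equiv.sumArrowEquivProdArrow]

theorem PpsRep.of_mem {R : Type} [CommSemiring R] {𝓕 : Set (Fn R)} {G : Fn R} (h : G ∈ 𝓕) :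
    PpsRep R 𝓕 G.2 :=
  PpsRep.of_fintype (B := Empty) (J := Unit) (fun _ => G) (fun _ i => Sum.inl i)
    (fun _ => h) (fun x => by simp)

/-- The submonoid of limits of functions represented by pps-formulas over `S`. -/
def ppsClosure (S : Set (Fn ℝ≥0)) (n : ℕ) : Submonoid (FnOn ℝ≥0 n) :=
  Submonoid.topologicalClosure
    { carrier := {f | PpsRep ℝ≥0 S f}
      one_mem' := PpsRep.one S n
      mul_mem' := PpsRep.mul }

theorem coe_ppsClosure (S : Set (Fn ℝ≥0)) (n : ℕ) :
    (ppsClosure S n : Set (FnOn ℝ≥0 n)) = closure {f | PpsRep ℝ≥0 S f} := rfl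

theorem isClosed_ppsClosure (S : Set (Fn ℝ≥0)) (n : ℕ) :
    IsClosed (ppsClosure S n : Set (FnOn ℝ≥0 n)) := isClosed_closure

theorem mem_ppsClosure_of_mem {S : Set (Fn ℝ≥0)} {G : Fn ℝ≥0} (h : G ∈ S) :
    G.2 ∈ ppsClosure S G.1 :=
  subset_closure (PpsRep.of_mem h)

theorem ppsClosure_rename {S : Set (Fn ℝ≥0)} {k n : ℕ} {f : FnOn ℝ≥0 k}
    (h : f ∈ ppsClosure S k) (τ : Fin k → Fin n) :
    (fun x : Fin n → Bool => f (x ∘ τ)) ∈ ppsClosure S n :=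
  map_mem_closure (f := fun (f : FnOn ℝ≥0 k) (x : Fin n → Bool) => f (x ∘ τ))
    (by fun_prop) h fun _ hg => PpsRep.rename hg τ

theorem ppsClosure_sum {S : Set (Fn ℝ≥0)} {n k : ℕ} {f : FnOn ℝ≥0 (n + k)}
    (h : f ∈ ppsClosure S (n + k)) :
    (fun x : Fin n → Bool => ∑ y : Fin k → Bool, f (Fin.append x y)) ∈ ppsClosure S n :=
  map_mem_closure
    (f := fun (f : FnOn ℝ≥0 (n + k)) (x : Fin n → Bool) => ∑ y : Fin k → Bool, f (Fin.append x y))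
    (by fun_prop) h fun _ hg => PpsRep.sum hg

theorem ppsClosure_le {S T : Set (Fn ℝ≥0)} (h : ∀ G ∈ S, G.2 ∈ ppsClosure T G.1) (n : ℕ) :
    ppsClosure S n ≤ ppsClosure T n := by
  refine closure_minimal ?_ (isClosed_ppsClosure T n)
  rintro f ⟨m, s, G, σ, hG, hf⟩
  have hprod : (∏ j, fun x : Fin (n + m) → Bool => (G j).2 (x ∘ σ j)) ∈ ppsClosure T (n + m) :=
    prod_mem fun j _ => ppsClosure_rename (h _ (hG j)) (σ j)
  have hsum := ppsClosure_sum hprod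
  simp only [Finset.prod_apply, Function.comp_def] at hsum
  rwa [← funext hf] at hsum

theorem mem_cloneOmega_iff {𝓕 : Set (Fn ℝ≥0)} {F : Fn ℝ≥0} :
    F ∈ CloneOmega ℝ≥0 𝓕 ↔
      ∃ S ⊆ 𝓕 ∪ {EQfn ℝ≥0}, S.Finite ∧ F.2 ∈ ppsClosure S F.1 := by
  refine exists_congr fun S => and_congr_right fun _ => and_congr_right fun _ => ?_
  rw [← SetLike.mem_coe, coe_ppsClosure, Metric.mem_closure_iff]
  refine forall_congr' fun ε => forall_congr' fun hε => exists_congr fun g =>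
    and_congr_right fun _ => ?_
  rw [dist_comm, dist_pi_lt_iff hε]

theorem subset_cloneOmega (𝓕 : Set (Fn ℝ≥0)) : 𝓕 ∪ {EQfn ℝ≥0} ⊆ CloneOmega ℝ≥0 𝓕 :=
  fun G hG => mem_cloneOmega_iff.2 ⟨{G}, by simpa using hG, Set.finite_singleton G,
    mem_ppsClosure_of_mem rfl⟩

theorem mem_cloneOmega_of_ppsClosure {𝓕 S : Set (Fn ℝ≥0)} (hfin : S.Finite)
    (hS : S ⊆ CloneOmega ℝ≥0 𝓕) {n : ℕ} {f : FnOn ℝ≥0 n} (hf : f ∈ ppsClosure S n) :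
    (⟨n, f⟩ : Fn ℝ≥0) ∈ CloneOmega ℝ≥0 𝓕 := by
  choose! T hT hTfin hmem using fun G hG => mem_cloneOmega_iff.1 (hS (a := G) hG)
  refine mem_cloneOmega_iff.2 ⟨⋃ G ∈ S, T G, Set.iUnion₂_subset hT, hfin.biUnion hTfin, ?_⟩
  refine ppsClosure_le (fun G hG => ?_) n hf
  refine ppsClosure_le (fun H hH => mem_ppsClosure_of_mem ?_) _ (hmem G hG)
  exact Set.mem_biUnion hG hH

theorem cloneOmega_subset {𝓕 𝓖 : Set (Fn ℝ≥0)} (h : 𝓖 ⊆ CloneOmega ℝ≥0 𝓕) :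
    CloneOmega ℝ≥0 𝓖 ⊆ CloneOmega ℝ≥0 𝓕 := by
  rintro ⟨n, f⟩ hf
  obtain ⟨S, hS, hfin, hmem⟩ := mem_cloneOmega_iff.1 hf
  refine mem_cloneOmega_of_ppsClosure hfin (hS.trans (Set.union_subset h ?_)) hmem
  exact Set.subset_union_right.trans (subset_cloneOmega 𝓕)

/-- The binary function with matrix `M`. -/
def binFn (M : Bool → Bool → ℝ≥0) : Fn ℝ≥0 := ⟨2, fun x => M (x 0) (x 1)⟩

/-- The unary function with values `u`. -/
def unFn (u : Bool → ℝ≥0) : Fn ℝ≥0 := ⟨1, fun x => u (x 0)⟩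

theorem binFn_mem_ppsClosure {S : Set (Fn ℝ≥0)} {M : Bool → Bool → ℝ≥0} (h : binFn M ∈ S) {n : ℕ}
    (i j : Fin n) : (fun x : Fin n → Bool => M (x i) (x j)) ∈ ppsClosure S n :=
  ppsClosure_rename (mem_ppsClosure_of_mem h) ![i, j]

theorem unFn_mem_ppsClosure {S : Set (Fn ℝ≥0)} {u : Bool → ℝ≥0} (h : unFn u ∈ S) {n : ℕ}
    (i : Fin n) : (fun x : Fin n → Bool => u (x i)) ∈ ppsClosure S n :=
  ppsClosure_rename (mem_ppsClosure_of_mem h) ![i]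

section Closure

variable {𝓕 : Set (Fn ℝ≥0)} {M N : Bool → Bool → ℝ≥0}

theorem unFn_mem_cloneOmega (hu : unaryFns ⊆ 𝓕) (u : Bool → ℝ≥0) :
    unFn u ∈ CloneOmega ℝ≥0 𝓕 :=
  subset_cloneOmega 𝓕 (Or.inl (hu rfl))

theorem binFn_congr (hM : binFn M ∈ CloneOmega ℝ≥0 𝓕) (h : ∀ a b, N a b = M a b) :
    binFn N ∈ CloneOmega ℝ≥0 𝓕 := by
  rwa [funext₂ h]

theorem binFn_mul_unary (hu : unaryFns ⊆ 𝓕) (hM : binFn M ∈ CloneOmega ℝ≥0 𝓕)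
    (u v : Bool → ℝ≥0) : binFn (fun a b => u a * v b * M a b) ∈ CloneOmega ℝ≥0 𝓕 := by
  refine mem_cloneOmega_of_ppsClosure (S := {unFn u, unFn v, binFn M}) (by simp) ?_
    (mul_mem (mul_mem (unFn_mem_ppsClosure (by simp) 0) (unFn_mem_ppsClosure (by simp) 1))
      (binFn_mem_ppsClosure (by simp) 0 1))
  rintro G (rfl | rfl | rfl)
  exacts [unFn_mem_cloneOmega hu u, unFn_mem_cloneOmega hu v, hM]

theorem binFn_transpose (hM : binFn M ∈ CloneOmega ℝ≥0 𝓕) :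
    binFn (fun a b => M b a) ∈ CloneOmega ℝ≥0 𝓕 :=
  mem_cloneOmega_of_ppsClosure (S := {binFn M}) (by simp) (by simpa using hM)
    (binFn_mem_ppsClosure (by simp) 1 0)

theorem binFn_comp (hu : unaryFns ⊆ 𝓕) (hM : binFn M ∈ CloneOmega ℝ≥0 𝓕)
    (hN : binFn N ∈ CloneOmega ℝ≥0 𝓕) (w : Bool → ℝ≥0) :
    binFn (fun a b => M a false * w false * N false b + M a true * w true * N true b) ∈
      CloneOmega ℝ≥0 𝓕 := by
  have hS : ({unFn w, binFn M, binFn N} : Set (Fn ℝ≥0)) ⊆ CloneOmega ℝ≥0 𝓕 := by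
    rintro G (rfl | rfl | rfl)
    exacts [unFn_mem_cloneOmega hu w, hM, hN]
  refine mem_cloneOmega_of_ppsClosure (by simp) hS ?_
  have h : (fun x : Fin (2 + 1) → Bool => M (x 0) (x 2) * w (x 2) * N (x 2) (x 1)) ∈
      ppsClosure {unFn w, binFn M, binFn N} (2 + 1) :=
    mul_mem (mul_mem (binFn_mem_ppsClosure (by simp) 0 2) (unFn_mem_ppsClosure (by simp) 2))
      (binFn_mem_ppsClosure (by simp) 2 1)
  convert ppsClosure_sum h using 1
  ext1 x
  rw [← (Equiv.funUnique (Fin 1) Bool).symm.sum_comp, Fintype.sum_bool, add_comm]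
  rfl

theorem binFn_lim (hM : binFn M ∈ CloneOmega ℝ≥0 𝓕)
    (hlim : ∀ a b, Filter.Tendsto (fun k : ℕ => M a b ^ k) Filter.atTop (nhds (N a b))) :
    binFn N ∈ CloneOmega ℝ≥0 𝓕 := by
  refine mem_cloneOmega_of_ppsClosure (S := {binFn M}) (by simp) (by simpa using hM) ?_
  refine (isClosed_ppsClosure {binFn M} 2).mem_of_tendsto
    (f := fun k : ℕ => (fun x : Fin 2 → Bool => M (x 0) (x 1)) ^ k)
    (tendsto_pi_nhds.2 fun x => hlim (x 0) (x 1))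
    (Filter.Eventually.of_forall fun k => pow_mem (binFn_mem_ppsClosure (S := {binFn M}) rfl 0 1) k)

theorem binFn_rank_one (hu : unaryFns ⊆ 𝓕) (u v : Bool → ℝ≥0) :
    binFn (fun a b => u a * v b) ∈ CloneOmega ℝ≥0 𝓕 := by
  have h : binFn (fun _ _ => 1) ∈ CloneOmega ℝ≥0 𝓕 :=
    mem_cloneOmega_of_ppsClosure Set.finite_empty (Set.empty_subset _) (one_mem _)
  simpa using binFn_mul_unary hu h u v

theorem binFn_mem_of_det_eq_zero (hu : unaryFns ⊆ 𝓕)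
    (hdet : M false false * M true true = M false true * M true false) :
    binFn M ∈ CloneOmega ℝ≥0 𝓕 := by
  have hminor : ∀ a b a' b', M a b * M a' b' = M a b' * M a' b := by
    simp only [Bool.forall_bool]
    grind
  by_cases h : ∀ a b, M a b = 0
  · exact binFn_congr (binFn_rank_one hu 0 0) (by simp [h])
  · push Not at h
    obtain ⟨a', b', hne⟩ := h
    refine binFn_congr (binFn_rank_one hu (fun a => M a b') (fun b => M a' b / M a' b'))
      fun a b => ?_
    rw [← mul_div_assoc, eq_div_iff hne, hminor]

/-- Multiplying by unary functions reaches every matrix with the same cross ratio. -/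
theorem binFn_mem_of_cross_ratio (hu : unaryFns ⊆ 𝓕) (hM : binFn M ∈ CloneOmega ℝ≥0 𝓕)
    (a b : Bool) (h₀ : M a b ≠ 0) (h₁ : M a (!b) ≠ 0) (h₂ : M (!a) b ≠ 0) (hN : N a b ≠ 0)
    (hcross : N a b * N (!a) (!b) * (M a (!b) * M (!a) b) =
      N a (!b) * N (!a) b * (M a b * M (!a) (!b))) :
    binFn N ∈ CloneOmega ℝ≥0 𝓕 := by
  refine binFn_congr (binFn_mul_unary hu hM (fun c => N c b / M c b)
    (fun c => N a c * M a b / (M a c * N a b))) fun c d => ?_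
  obtain rfl | rfl : c = a ∨ c = !a := by cases a <;> cases c <;> simp
  all_goals obtain rfl | rfl : d = b ∨ d = !b := by cases b <;> cases d <;> simp
  all_goals field_simp
  linear_combination hcross

/-- The matrix whose only zero entry is at `(a, b)` and whose other entries are `1`. -/
def zeroAt (a b : Bool) : Bool → Bool → ℝ≥0 := fun c d => if c = a ∧ d = b then 0 else 1

theorem zeroAt_mem (hu : unaryFns ⊆ 𝓕) (hM : binFn M ∈ CloneOmega ℝ≥0 𝓕)
    (a b : Bool) (h₀ : M (!a) (!b) ≠ 0) (h₁ : M (!a) b ≠ 0) (h₂ : M a (!b) ≠ 0)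
    (hlt : M (!a) (!b) * M a b < M (!a) b * M a (!b)) :
    binFn (zeroAt a b) ∈ CloneOmega ℝ≥0 𝓕 := by
  set r : ℝ≥0 := M (!a) (!b) * M a b / (M (!a) b * M a (!b)) with hr
  have hr1 : r < 1 := (div_lt_one (by positivity)).2 hlt
  have hscaled : binFn (fun c d => if c = a ∧ d = b then r else 1) ∈ CloneOmega ℝ≥0 𝓕 := by
    refine binFn_mem_of_cross_ratio hu hM (!a) (!b) h₀ (by simpa) (by simpa) (by simp) ?_
    simp only [Bool.not_not, hr]
    simp
    field_simp
  refine binFn_lim hscaled fun c d => ?_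
  by_cases h : c = a ∧ d = b
  · simpa [zeroAt, h] using NNReal.tendsto_pow_atTop_nhds_zero_of_lt_one hr1
  · simp [zeroAt, h]

theorem binFn_comp_three (hu : unaryFns ⊆ 𝓕) (hM : binFn M ∈ CloneOmega ℝ≥0 𝓕)
    (v w : Bool → ℝ≥0) :
    binFn (fun a b =>
      M a false * v false *
        (M false false * w false * M false b + M false true * w true * M true b) +
      M a true * v true *
        (M true false * w false * M false b + M true true * w true * M true b)) ∈
      CloneOmega ℝ≥0 𝓕 :=
  binFn_comp hu hM (binFn_comp hu hM hM w) v

theorem zeroAt_true_mem_of_zeroAt_false (hu : unaryFns ⊆ 𝓕)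
    (h : binFn (zeroAt false false) ∈ CloneOmega ℝ≥0 𝓕) :
    binFn (zeroAt true true) ∈ CloneOmega ℝ≥0 𝓕 := by
  refine zeroAt_mem hu (binFn_comp_three hu h 1 1) true true ?_ ?_ ?_ ?_ <;>
    norm_num [zeroAt]

theorem zeroAt_false_mem_of_zeroAt_true (hu : unaryFns ⊆ 𝓕)
    (h : binFn (zeroAt true true) ∈ CloneOmega ℝ≥0 𝓕) :
    binFn (zeroAt false false) ∈ CloneOmega ℝ≥0 𝓕 := by
  refine zeroAt_mem hu (binFn_comp_three hu h 1 1) false false ?_ ?_ ?_ ?_ <;>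
    norm_num [zeroAt]

/-- Matrices with positive entries on and above the diagonal and positive determinant are
generated by implication. -/
theorem binFn_mem_of_imp (hu : unaryFns ⊆ 𝓕)
    (h : binFn (zeroAt true false) ∈ CloneOmega ℝ≥0 𝓕)
    (h₀₀ : 0 < M false false) (h₀₁ : 0 < M false true) (h₁₁ : 0 < M true true)
    (hlt : M false true * M true false < M false false * M true true) :
    binFn M ∈ CloneOmega ℝ≥0 𝓕 := by
  rcases eq_or_ne (M true false) 0 with h₁₀ | h₁₀
  · exact binFn_mem_of_cross_ratio hu h false true (by simp [zeroAt]) (by simp [zeroAt])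
      (by simp [zeroAt]) h₀₁.ne' (by simp [zeroAt, h₁₀])
  · obtain ⟨d, hd⟩ := exists_add_of_le hlt.le
    have hq : M false true * M true false ≠ 0 := mul_ne_zero h₀₁.ne' h₁₀
    refine binFn_mem_of_cross_ratio hu
      (binFn_comp hu (binFn_transpose h) h
        (fun a => bif a then d else M false true * M true false)) false true ?_ ?_ ?_ h₀₁.ne' ?_
    · simpa [zeroAt] using hq
    · simpa [zeroAt] using hq
    · simp [zeroAt, ← hd, h₀₀.ne', h₁₁.ne']
    · simp [zeroAt, ← hd]
      ring

/-- Matrices with positive off-diagonal entries and negative determinant are generated by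
disjunction, provided that the diagonal is not identically zero. -/
theorem binFn_mem_of_or (hu : unaryFns ⊆ 𝓕)
    (h : binFn (zeroAt false false) ∈ CloneOmega ℝ≥0 𝓕)
    (hdiag : M false false ≠ 0 ∨ M true true ≠ 0)
    (hlt : M false false * M true true < M false true * M true false) :
    binFn M ∈ CloneOmega ℝ≥0 𝓕 := by
  rcases eq_or_ne (M true true) 0 with h₁₁ | h₁₁
  · have h₀₀ : M false false ≠ 0 := by simpa [h₁₁] using hdiag
    exact binFn_mem_of_cross_ratio hu (zeroAt_true_mem_of_zeroAt_false hu h) false false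
      (by simp [zeroAt]) (by simp [zeroAt]) (by simp [zeroAt]) h₀₀ (by simp [zeroAt, h₁₁])
  rcases eq_or_ne (M false false) 0 with h₀₀ | h₀₀
  · exact binFn_mem_of_cross_ratio hu h true true
      (by simp [zeroAt]) (by simp [zeroAt]) (by simp [zeroAt]) h₁₁ (by simp [zeroAt, h₀₀])
  obtain ⟨d, hd⟩ := exists_add_of_le hlt.le
  have hp : M false false * M true true ≠ 0 := mul_ne_zero h₀₀ h₁₁
  have hp' := mul_comm (M true true) (M false false)
  have hq' := mul_comm (M true false) (M false true)
  generalize M false false * M true true = p at *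
  generalize M false true * M true false = q at *
  refine binFn_mem_of_cross_ratio hu
    (binFn_comp_three hu h (fun a => bif a then p else q)
      (fun a => bif a then p * p else d * (2 * p + d))) true true ?_ ?_ ?_ h₁₁ ?_
  · simp [zeroAt, hp]
  · simp [zeroAt, hp]
  · simp [zeroAt, hp]
  · simp only [Bool.not_true, hp', hq', hd]
    simp [zeroAt]
    ring

theorem zeroAt_false_mem_of_det_neg (hu : unaryFns ⊆ 𝓕) (hM : binFn M ∈ CloneOmega ℝ≥0 𝓕)
    (h₀₁ : M false true ≠ 0) (h₁₀ : M true false ≠ 0)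
    (hdiag : M false false ≠ 0 ∨ M true true ≠ 0)
    (hlt : M false false * M true true < M false true * M true false) :
    binFn (zeroAt false false) ∈ CloneOmega ℝ≥0 𝓕 := by
  rcases eq_or_ne (M true true) 0 with h₁₁ | h₁₁
  · have h₀₀ : M false false ≠ 0 := by simpa [h₁₁] using hdiag
    exact zeroAt_false_mem_of_zeroAt_true hu (zeroAt_mem hu hM true true h₀₀ h₀₁ h₁₀ hlt)
  · refine zeroAt_mem hu hM false false h₁₁ h₁₀ h₀₁ ?_
    simpa only [Bool.not_false, mul_comm] using hlt

end Closure

theorem cloneOmega_union_eq {𝓕 : Set (Fn ℝ≥0)} {G : Fn ℝ≥0} (hG : G ∈ CloneOmega ℝ≥0 𝓕) :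
    CloneOmega ℝ≥0 ({G} ∪ 𝓕) = CloneOmega ℝ≥0 𝓕 := by
  refine (cloneOmega_subset (Set.union_subset (by simpa using hG) ?_)).antisymm
    (cloneOmega_subset (Set.Subset.trans ?_ (subset_cloneOmega _)))
  · exact Set.subset_union_left.trans (subset_cloneOmega 𝓕)
  · exact Set.subset_union_right.trans Set.subset_union_left

theorem cloneOmega_union_eq_union {𝓕 : Set (Fn ℝ≥0)} {G H : Fn ℝ≥0}
    (hG : G ∈ CloneOmega ℝ≥0 ({H} ∪ 𝓕)) (hH : H ∈ CloneOmega ℝ≥0 ({G} ∪ 𝓕)) :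
    CloneOmega ℝ≥0 ({G} ∪ 𝓕) = CloneOmega ℝ≥0 ({H} ∪ 𝓕) := by
  rw [← cloneOmega_union_eq hG, ← cloneOmega_union_eq hH, Set.union_left_comm]

theorem mem_cloneOmega_union (𝓕 : Set (Fn ℝ≥0)) (G : Fn ℝ≥0) :
    G ∈ CloneOmega ℝ≥0 ({G} ∪ 𝓕) :=
  subset_cloneOmega _ (by simp)

theorem eqFn_eq_binFn : EQfn ℝ≥0 = binFn (fun a b => if a = b then 1 else 0) := rfl

theorem neqFn_eq_binFn : NEQfn = binFn (fun a b => if a ≠ b then 1 else 0) := rfl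

theorem impFn_eq_binFn : IMPfn = binFn (zeroAt true false) := rfl

theorem orFn_eq_binFn : ORfn = binFn (zeroAt false false) := rfl

theorem eq_binFn (F : FnOn ℝ≥0 2) : (⟨2, F⟩ : Fn ℝ≥0) = binFn (fun a b => F ![a, b]) := by
  refine congrArg (Sigma.mk 2) (funext fun x => congrArg F (funext fun i => ?_))
  fin_cases i <;> rfl

/-- Lemma (binary cases): classification of `⟨F, ℬ₁⟩_ω` for a binary function `F` with
`f₀₁ ≥ f₁₀`. -/
theorem binary_cases (F : FnOn ℝ≥0 2)
    (hasym : F ![true, false] ≤ F ![false, true]) :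
    (F ![false, false] * F ![true, true] = F ![false, true] * F ![true, false] →
      CloneOmega ℝ≥0 ({⟨2, F⟩} ∪ unaryFns) = CloneOmega ℝ≥0 unaryFns) ∧
    (F ![false, true] = 0 ∧ F ![true, false] = 0 ∧
        0 < F ![false, false] ∧ 0 < F ![true, true] →
      CloneOmega ℝ≥0 ({⟨2, F⟩} ∪ unaryFns) = CloneOmega ℝ≥0 unaryFns) ∧
    (F ![false, false] = 0 ∧ F ![true, true] = 0 ∧
        0 < F ![false, true] ∧ 0 < F ![true, false] →
      CloneOmega ℝ≥0 ({⟨2, F⟩} ∪ unaryFns) = CloneOmega ℝ≥0 ({NEQfn} ∪ unaryFns)) ∧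
    (0 < F ![false, false] ∧ 0 < F ![false, true] ∧ 0 < F ![true, true] ∧
        F ![false, true] * F ![true, false] < F ![false, false] * F ![true, true] →
      CloneOmega ℝ≥0 ({⟨2, F⟩} ∪ unaryFns) = CloneOmega ℝ≥0 ({IMPfn} ∪ unaryFns)) ∧
    (¬ (F ![false, false] * F ![true, true] = F ![false, true] * F ![true, false]) ∧
     ¬ (F ![false, true] = 0 ∧ F ![true, false] = 0 ∧
          0 < F ![false, false] ∧ 0 < F ![true, true]) ∧
     ¬ (F ![false, false] = 0 ∧ F ![true, true] = 0 ∧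
          0 < F ![false, true] ∧ 0 < F ![true, false]) ∧
     ¬ (0 < F ![false, false] ∧ 0 < F ![false, true] ∧ 0 < F ![true, true] ∧
          F ![false, true] * F ![true, false] < F ![false, false] * F ![true, true]) →
      CloneOmega ℝ≥0 ({⟨2, F⟩} ∪ unaryFns) = CloneOmega ℝ≥0 ({ORfn} ∪ unaryFns)) := by
  rw [eq_binFn F]
  set M : Bool → Bool → ℝ≥0 := fun a b => F ![a, b] with hM
  have hMF (a b : Bool) : F ![a, b] = M a b := rfl
  simp only [hMF] at hasym ⊢
  clear_value M
  have hu (G : Fn ℝ≥0) : unaryFns ⊆ {G} ∪ unaryFns := Set.subset_union_right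
  have hself := mem_cloneOmega_union unaryFns
  refine ⟨fun h => ?_, fun h => ?_, fun h => ?_, fun h => ?_, fun h => ?_⟩
  · exact cloneOmega_union_eq (binFn_mem_of_det_eq_zero subset_rfl h)
  · obtain ⟨h₀₁, h₁₀, -, -⟩ := h
    have hEQ : EQfn ℝ≥0 ∈ CloneOmega ℝ≥0 unaryFns := subset_cloneOmega _ (by simp)
    rw [eqFn_eq_binFn] at hEQ
    refine cloneOmega_union_eq (binFn_congr
      (binFn_mul_unary subset_rfl hEQ (fun a => M a a) 1) ?_)
    simp [h₀₁, h₁₀]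
  · obtain ⟨h₀₀, h₁₁, h₀₁, h₁₀⟩ := h
    rw [neqFn_eq_binFn]
    refine cloneOmega_union_eq_union
      (binFn_congr (binFn_mul_unary (hu _) (hself _) (fun a => M a (!a)) 1) ?_)
      (binFn_congr (binFn_mul_unary (hu _) (hself _) (fun a => (M a (!a))⁻¹) 1) ?_)
    · simp [h₀₀, h₁₁]
    · simp [h₀₀, h₁₁, h₀₁.ne', h₁₀.ne']
  · obtain ⟨h₀₀, h₀₁, h₁₁, hlt⟩ := h
    rw [impFn_eq_binFn]
    exact cloneOmega_union_eq_union (binFn_mem_of_imp (hu _) (hself _) h₀₀ h₀₁ h₁₁ hlt)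
      (zeroAt_mem (hu _) (hself _) true false h₀₁.ne' h₀₀.ne' h₁₁.ne' hlt)
  · obtain ⟨hdet, hdiag, hanti, himp⟩ := h
    have h₀₁ : M false true ≠ 0 := by
      intro h₀₁
      have h₁₀ : M true false = 0 := le_antisymm (h₀₁ ▸ hasym) zero_le
      simp only [h₀₁, h₁₀, mul_zero, mul_eq_zero, not_or] at hdet
      exact hdiag ⟨h₀₁, h₁₀, pos_iff_ne_zero.2 hdet.1, pos_iff_ne_zero.2 hdet.2⟩
    have hlt : M false false * M true true < M false true * M true false := by
      refine lt_of_le_of_ne (not_lt.1 fun hgt => himp ?_) hdet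
      have hpos := zero_le.trans_lt hgt
      exact ⟨pos_of_mul_pos_left hpos zero_le, pos_iff_ne_zero.2 h₀₁,
        pos_of_mul_pos_right hpos zero_le, hgt⟩
    have h₁₀ : M true false ≠ 0 := right_ne_zero_of_mul (zero_le.trans_lt hlt).ne'
    have hdiag' : M false false ≠ 0 ∨ M true true ≠ 0 := by
      by_contra! h
      exact hanti ⟨h.1, h.2, pos_iff_ne_zero.2 h₀₁, pos_iff_ne_zero.2 h₁₀⟩
    rw [orFn_eq_binFn]
    exact cloneOmega_union_eq_union (binFn_mem_of_or (hu _) (hself _) hdiag' hlt)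
      (zeroAt_false_mem_of_det_neg (hu _) (hself _) h₀₁ h₁₀ hdiag' hlt)
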